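/- arXiv:1601.04276 — 2 statements merged into one kernel-verified Lean document; each statement's English description precedes it below -/
import Mathlib

section
/- Fix finite nonempty sets 𝒳, 𝒵, a pmf P on 𝒳, a channel W from 𝒳 to 𝒵, and a pmf Q_Z on 𝒵. Assume there exists a channel V₀ from 𝒳 to 𝒵 with P∘V₀ = Q_Z and with V₀(z|x) > 0 implying W(z|x) > 0 for all x with P(x)>0. Then min{ D(V‖W|P) : V a channel with P∘V = Q_Z } = sup over functions ρ : 𝒵 → ℝ of { Σ_z ρ(z) Q_Z(z) − Σ_x P(x) ln Σ_z W(z|x) e^{ρ(z)} }. -/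
open Filter

noncomputable section

/-- A probability mass function on a finite alphabet. -/
def IsPMF {α : Type*} [Fintype α] (p : α → ℝ) : Prop :=
  (∀ a, 0 ≤ p a) ∧ ∑ a, p a = 1

/-- A channel from `𝒳` to `𝒵`: each input is mapped to a pmf on `𝒵`. -/
def IsChannel {𝒳 𝒵 : Type*} [Fintype 𝒵] (W : 𝒳 → 𝒵 → ℝ) : Prop :=
  ∀ x, IsPMF (W x)

/-- Absolute continuity: `Q a > 0` implies `Q' a > 0`. -/
def AbsCont {α : Type*} (Q Q' : α → ℝ) : Prop :=
  ∀ a, 0 < Q a → 0 < Q' a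

/-- Kullback–Leibler divergence `D(Q‖Q')` (the sum over the support of `Q`). -/
def klDiv {α : Type*} [Fintype α] (Q Q' : α → ℝ) : ℝ :=
  ∑ a, if 0 < Q a then Q a * Real.log (Q a / Q' a) else 0

/-- `x`-marginal of a joint distribution. -/
def margX {𝒳 𝒵 : Type*} [Fintype 𝒵] (Q : 𝒳 × 𝒵 → ℝ) : 𝒳 → ℝ :=
  fun x => ∑ z, Q (x, z)

/-- `z`-marginal of a joint distribution. -/
def margZ {𝒳 𝒵 : Type*} [Fintype 𝒳] (Q : 𝒳 × 𝒵 → ℝ) : 𝒵 → ℝ :=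
  fun z => ∑ x, Q (x, z)

/-- The joint pmf `(x,z) ↦ P(x) W(z|x)`. -/
def jointPW {𝒳 𝒵 : Type*} (P : 𝒳 → ℝ) (W : 𝒳 → 𝒵 → ℝ) : 𝒳 × 𝒵 → ℝ :=
  fun p => P p.1 * W p.1 p.2

/-- The function `f(Q‖Q') = Σ_{Q(x,z)>0} Q(x,z) ln( Q'(x,z) / (Q'_X(x) Q'_Z(z)) )`. -/
def fFun {𝒳 𝒵 : Type*} [Fintype 𝒳] [Fintype 𝒵] (Q Q' : 𝒳 × 𝒵 → ℝ) : ℝ :=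
  ∑ p, if 0 < Q p then Q p * Real.log (Q' p / (margX Q' p.1 * margZ Q' p.2)) else 0

/-- The output distribution `(P∘V)(z) = Σ_x P(x)V(z|x)`. -/
def outDist {𝒳 𝒵 : Type*} [Fintype 𝒳] (P : 𝒳 → ℝ) (V : 𝒳 → 𝒵 → ℝ) : 𝒵 → ℝ :=
  fun z => ∑ x, P x * V x z

/-- Conditional KL divergence `D(V‖W|P) = Σ_x P(x) D(V(·|x)‖W(·|x))`, with value `+∞`
whenever some `x, z` with `P(x) > 0` have `V(z|x) > 0 = W(z|x)`. -/
def condKL {𝒳 𝒵 : Type*} [Fintype 𝒳] [Fintype 𝒵]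
    (V W : 𝒳 → 𝒵 → ℝ) (P : 𝒳 → ℝ) : EReal :=
  if ∀ x z, 0 < P x → 0 < V x z → 0 < W x z then
    ((∑ x, P x * klDiv (V x) (W x) : ℝ) : EReal)
  else ⊤

section Duality

variable {α 𝒳 𝒵 : Type*} [Fintype α] [Fintype 𝒵]

lemma klDiv_eq_sum_log_sub_log {Q Q' : α → ℝ} (hQ : ∀ a, 0 ≤ Q a) (h : AbsCont Q Q') :
    klDiv Q Q' = ∑ a, (Q a * Real.log (Q a) - Q a * Real.log (Q' a)) := by
  refine Finset.sum_congr rfl fun a _ => ?_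
  split_ifs with ha
  · rw [Real.log_div ha.ne' (h a ha).ne', mul_sub]
  · simp [le_antisymm (not_lt.1 ha) (hQ a)]

lemma IsPMF.sum_mul_exp_pos {Q : α → ℝ} (hQ : IsPMF Q) (ρ : α → ℝ) :
    0 < ∑ a, Q a * Real.exp (ρ a) := by
  refine lt_of_le_of_ne (Finset.sum_nonneg fun a _ => mul_nonneg (hQ.1 a) (Real.exp_pos _).le) ?_
  intro h
  have h0 := (Finset.sum_eq_zero_iff_of_nonneg
    fun a _ => mul_nonneg (hQ.1 a) (Real.exp_pos (ρ a)).le).1 h.symm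
  have h1 : ∑ a, Q a = 0 := Finset.sum_eq_zero fun a ha =>
    (mul_eq_zero.1 (h0 a ha)).resolve_right (Real.exp_pos _).ne'
  linarith [hQ.2]

/-- The Donsker–Varadhan lower bound on the divergence. -/
lemma sum_mul_sub_log_le_klDiv {Q Q' : α → ℝ} (hQ : IsPMF Q) (hQ' : IsPMF Q')
    (h : AbsCont Q Q') (ρ : α → ℝ) :
    ∑ a, ρ a * Q a - Real.log (∑ a, Q' a * Real.exp (ρ a)) ≤ klDiv Q Q' := by
  have hZ := hQ'.sum_mul_exp_pos ρ
  set Z := ∑ a, Q' a * Real.exp (ρ a) with hZdef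
  have key : ∀ a, Q a - Q' a * Real.exp (ρ a) / Z ≤
      (Q a * Real.log (Q a) - Q a * Real.log (Q' a)) - ρ a * Q a + Q a * Real.log Z := by
    intro a
    rcases (hQ.1 a).eq_or_lt with ha | ha
    · have : 0 ≤ Q' a * Real.exp (ρ a) / Z :=
        div_nonneg (mul_nonneg (hQ'.1 a) (Real.exp_pos _).le) hZ.le
      simpa [← ha] using this
    · have ha' := h a ha
      have hlog := Real.log_le_sub_one_of_pos
        (show 0 < Q' a * Real.exp (ρ a) / (Q a * Z) by positivity)
      rw [Real.log_div (by positivity) (by positivity), Real.log_mul ha'.ne' (Real.exp_pos _).ne',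
        Real.log_mul ha.ne' hZ.ne', Real.log_exp] at hlog
      have hmul := mul_le_mul_of_nonneg_left hlog ha.le
      have hcancel : Q a * (Q' a * Real.exp (ρ a) / (Q a * Z) - 1)
          = Q' a * Real.exp (ρ a) / Z - Q a := by
        field_simp
      rw [hcancel] at hmul
      linarith
  have hsum := Finset.sum_le_sum fun a (_ : a ∈ Finset.univ) => key a
  rw [Finset.sum_sub_distrib, ← Finset.sum_div, ← hZdef, div_self hZ.ne', hQ.2,
    Finset.sum_add_distrib, Finset.sum_sub_distrib, ← klDiv_eq_sum_log_sub_log hQ.1 h,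
    ← Finset.sum_mul, hQ.2] at hsum
  linarith

/-- The exponential tilting of the channel `W` by `ρ`. -/
def tilt (W : 𝒳 → 𝒵 → ℝ) (ρ : 𝒵 → ℝ) : 𝒳 → 𝒵 → ℝ :=
  fun x z => W x z * Real.exp (ρ z) / ∑ z', W x z' * Real.exp (ρ z')

lemma isChannel_tilt {W : 𝒳 → 𝒵 → ℝ} (hW : IsChannel W) (ρ : 𝒵 → ℝ) : IsChannel (tilt W ρ) := by
  intro x
  have hZ := (hW x).sum_mul_exp_pos ρ
  refine ⟨fun z => div_nonneg (mul_nonneg ((hW x).1 z) (Real.exp_pos _).le) hZ.le, ?_⟩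
  simp only [tilt]
  rw [← Finset.sum_div, div_self hZ.ne']

lemma klDiv_tilt {W : 𝒳 → 𝒵 → ℝ} (hW : IsChannel W) (ρ : 𝒵 → ℝ) (x : 𝒳) :
    klDiv (tilt W ρ x) (W x) =
      ∑ z, ρ z * tilt W ρ x z - Real.log (∑ z, W x z * Real.exp (ρ z)) := by
  have hZ := (hW x).sum_mul_exp_pos ρ
  have hT := isChannel_tilt hW ρ x
  have hlog : Real.log (∑ z, W x z * Real.exp (ρ z)) =
      ∑ z, tilt W ρ x z * Real.log (∑ z, W x z * Real.exp (ρ z)) := by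
    rw [← Finset.sum_mul, hT.2, one_mul]
  rw [hlog, ← Finset.sum_sub_distrib]
  refine Finset.sum_congr rfl fun z _ => ?_
  split_ifs with hz
  · have hWz : W x z ≠ 0 := fun h0 => by simp [tilt, h0] at hz
    have hdiv : tilt W ρ x z / W x z = Real.exp (ρ z) / ∑ z, W x z * Real.exp (ρ z) := by
      rw [tilt]; field_simp
    rw [hdiv, Real.log_div (Real.exp_pos _).ne' hZ.ne', Real.log_exp]
    ring
  · simp [le_antisymm (not_lt.1 hz) (hT.1 z)]

lemma isCompact_setOf_isChannel : IsCompact {V : 𝒳 → 𝒵 → ℝ | IsChannel V} := by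
  have h : {V : 𝒳 → 𝒵 → ℝ | IsChannel V} = Set.univ.pi fun _ : 𝒳 => stdSimplex ℝ 𝒵 := by
    ext V
    simp [IsChannel, IsPMF, stdSimplex]
  rw [h]
  exact isCompact_univ_pi fun _ => isCompact_stdSimplex ℝ 𝒵

variable [Fintype 𝒳]

/-- The dual objective `ρ ↦ Σ_z ρ(z) Q(z) − Σ_x P(x) ln Σ_z W(z|x) e^{ρ(z)}`. -/
def dualObj (P : 𝒳 → ℝ) (W : 𝒳 → 𝒵 → ℝ) (Q : 𝒵 → ℝ) (ρ : 𝒵 → ℝ) : ℝ :=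
  (∑ z, ρ z * Q z) - ∑ x, P x * Real.log (∑ z, W x z * Real.exp (ρ z))

lemma sum_mul_outDist (P : 𝒳 → ℝ) (V : 𝒳 → 𝒵 → ℝ) (ρ : 𝒵 → ℝ) :
    ∑ z, ρ z * outDist P V z = ∑ x, P x * ∑ z, ρ z * V x z := by
  simp only [outDist, Finset.mul_sum]
  rw [Finset.sum_comm]
  exact Finset.sum_congr rfl fun x _ => Finset.sum_congr rfl fun z _ => by ring

lemma dualObj_le_sum_klDiv {P : 𝒳 → ℝ} {V W : 𝒳 → 𝒵 → ℝ} {Q : 𝒵 → ℝ} (hP : ∀ x, 0 ≤ P x)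
    (hV : IsChannel V) (hW : IsChannel W) (hout : ∀ z, outDist P V z = Q z)
    (h : ∀ x z, 0 < P x → 0 < V x z → 0 < W x z) (ρ : 𝒵 → ℝ) :
    dualObj P W Q ρ ≤ ∑ x, P x * klDiv (V x) (W x) := by
  have hlin : ∑ z, ρ z * Q z = ∑ x, P x * ∑ z, ρ z * V x z := by
    rw [← sum_mul_outDist]
    exact Finset.sum_congr rfl fun z _ => by rw [hout]
  rw [dualObj, hlin, ← Finset.sum_sub_distrib]
  refine Finset.sum_le_sum fun x _ => ?_
  rw [← mul_sub]
  rcases (hP x).eq_or_lt with hx | hx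
  · simp [← hx]
  · exact mul_le_mul_of_nonneg_left
      (sum_mul_sub_log_le_klDiv (hV x) (hW x) (fun z => h x z hx) ρ) hx.le

lemma sum_klDiv_tilt (P : 𝒳 → ℝ) {W : 𝒳 → 𝒵 → ℝ} (hW : IsChannel W) (Q ρ : 𝒵 → ℝ) :
    ∑ x, P x * klDiv (tilt W ρ x) (W x) =
      dualObj P W Q ρ + ∑ z, ρ z * (outDist P (tilt W ρ) z - Q z) := by
  simp only [klDiv_tilt hW, mul_sub, Finset.sum_sub_distrib, sum_mul_outDist, dualObj]
  ring

lemma continuous_dualObj (P : 𝒳 → ℝ) {W : 𝒳 → 𝒵 → ℝ} (hW : IsChannel W) (Q : 𝒵 → ℝ) :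
    Continuous (dualObj P W Q) := by
  unfold dualObj
  refine Continuous.sub (by fun_prop) (continuous_finsetSum _ fun x _ => ?_)
  exact continuous_const.mul
    (Continuous.log (by fun_prop) fun ρ => ((hW x).sum_mul_exp_pos ρ).ne')

lemma hasDerivAt_dualObj (P : 𝒳 → ℝ) {W : 𝒳 → 𝒵 → ℝ} (hW : IsChannel W) (Q ρ δ : 𝒵 → ℝ) :
    HasDerivAt (fun t : ℝ => dualObj P W Q (fun z => ρ z + t * δ z))
      (∑ z, δ z * (Q z - outDist P (tilt W ρ) z)) 0 := by
  have hline : ∀ z, HasDerivAt (fun t : ℝ => ρ z + t * δ z) (δ z) 0 := fun z => by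
    simpa using ((hasDerivAt_id (0 : ℝ)).mul_const (δ z)).const_add (ρ z)
  have hlin : HasDerivAt (fun t : ℝ => ∑ z, (ρ z + t * δ z) * Q z) (∑ z, δ z * Q z) 0 :=
    HasDerivAt.fun_sum fun z _ => (hline z).mul_const (Q z)
  have hlog : HasDerivAt
      (fun t : ℝ => ∑ x, P x * Real.log (∑ z, W x z * Real.exp (ρ z + t * δ z)))
      (∑ x, P x * ∑ z, δ z * tilt W ρ x z) 0 := by
    refine HasDerivAt.fun_sum fun x _ => HasDerivAt.const_mul (P x) ?_
    have hsum : HasDerivAt (fun t : ℝ => ∑ z, W x z * Real.exp (ρ z + t * δ z))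
        (∑ z, W x z * (Real.exp (ρ z + 0 * δ z) * δ z)) 0 :=
      HasDerivAt.fun_sum fun z _ => ((hline z).exp).const_mul (W x z)
    refine (hsum.log ((hW x).sum_mul_exp_pos _).ne').congr_deriv ?_
    simp only [zero_mul, add_zero, tilt, Finset.sum_div]
    exact Finset.sum_congr rfl fun z _ => by ring
  refine (hlin.sub hlog).congr_deriv ?_
  rw [← sum_mul_outDist, ← Finset.sum_sub_distrib]
  exact Finset.sum_congr rfl fun z _ => by ring

lemma dualObj_zero (P : 𝒳 → ℝ) {W : 𝒳 → 𝒵 → ℝ} (hW : IsChannel W) (Q : 𝒵 → ℝ) :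
    dualObj P W Q 0 = 0 := by
  simp [dualObj, (hW _).2]

lemma norm_sq_le_sum_sq (ρ : α → ℝ) : ‖ρ‖ ^ 2 ≤ ∑ a, ρ a ^ 2 := by
  have hnn : 0 ≤ ∑ a, ρ a ^ 2 := Finset.sum_nonneg fun a _ => sq_nonneg _
  rw [← Real.le_sqrt (norm_nonneg _) hnn, pi_norm_le_iff_of_nonneg (Real.sqrt_nonneg _)]
  intro a
  refine Real.abs_le_sqrt ?_
  exact Finset.single_le_sum (f := fun a => ρ a ^ 2) (fun a _ => sq_nonneg _) (Finset.mem_univ a)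

/-- A dual objective bounded above has, after subtracting `ε Σ ρ²`, a maximizer; its first-order
condition identifies the output distribution of the tilted channel. -/
lemma exists_regularized_dual_maximizer {P : 𝒳 → ℝ} {W : 𝒳 → 𝒵 → ℝ} (hW : IsChannel W)
    {Q : 𝒵 → ℝ} {B ε : ℝ} (hB : ∀ ρ, dualObj P W Q ρ ≤ B) (hε : 0 < ε) :
    ∃ ρ : 𝒵 → ℝ, (∀ z, outDist P (tilt W ρ) z - Q z = -(2 * ε * ρ z)) ∧
      ε * ∑ z, ρ z ^ 2 ≤ B := by
  classical
  have hcont : Continuous fun ρ : 𝒵 → ℝ => dualObj P W Q ρ - ε * ∑ z, ρ z ^ 2 :=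
    (continuous_dualObj P hW Q).sub (by fun_prop)
  obtain ⟨ρ, hρ⟩ := hcont.exists_forall_ge' 0 (by
    have hlim : Tendsto (fun ρ : 𝒵 → ℝ => ε * ‖ρ‖ ^ 2) (cocompact _) atTop :=
      ((tendsto_pow_atTop two_ne_zero).comp (tendsto_norm_cocompact_atTop)).const_mul_atTop hε
    filter_upwards [hlim.eventually_ge_atTop B] with ρ h
    have := mul_le_mul_of_nonneg_left (norm_sq_le_sum_sq ρ) hε.le
    simp only [dualObj_zero P hW Q, Pi.zero_apply, ne_eq, OfNat.ofNat_ne_zero, not_false_eq_true,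
      zero_pow, Finset.sum_const_zero, mul_zero, sub_zero]
    linarith [hB ρ])
  refine ⟨ρ, fun z => ?_, ?_⟩
  · have hsq : HasDerivAt (fun t : ℝ => ε * ∑ w, (ρ w + t * Pi.single (M := fun _ => ℝ) z 1 w) ^ 2)
        (2 * ε * ρ z) 0 := by
      have h : ∀ w, HasDerivAt (fun t : ℝ => (ρ w + t * Pi.single (M := fun _ => ℝ) z 1 w) ^ 2)
          (2 * ρ w * Pi.single (M := fun _ => ℝ) z 1 w) 0 := fun w => by
        refine ((((hasDerivAt_id (0 : ℝ)).mul_const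
          (Pi.single (M := fun _ => ℝ) z 1 w)).const_add (ρ w)).pow 2).congr_deriv ?_
        simp
      refine ((HasDerivAt.fun_sum fun w (_ : w ∈ Finset.univ) => h w).const_mul ε).congr_deriv ?_
      simp [Pi.single_apply]
      ring
    have hder := (hasDerivAt_dualObj P hW Q ρ (Pi.single z 1)).sub hsq
    have hmax : IsLocalMax ((fun t : ℝ => dualObj P W Q
          (fun w => ρ w + t * Pi.single (M := fun _ => ℝ) z 1 w)) -
        fun t : ℝ => ε * ∑ w, (ρ w + t * Pi.single (M := fun _ => ℝ) z 1 w) ^ 2) 0 :=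
      Eventually.of_forall fun t => by simpa using hρ _
    have h0 := hmax.hasDerivAt_eq_zero hder
    simp [Pi.single_apply] at h0
    linarith
  · have h0 := hρ 0
    simp [dualObj_zero P hW Q] at h0
    linarith [hB ρ]

lemma exists_channel_sum_klDiv_le {P : 𝒳 → ℝ} {W : 𝒳 → 𝒵 → ℝ} (hW : IsChannel W)
    {Q : 𝒵 → ℝ} {B : ℝ} (hB : ∀ ρ, dualObj P W Q ρ ≤ B) :
    ∃ V : 𝒳 → 𝒵 → ℝ, IsChannel V ∧ (∀ z, outDist P V z = Q z) ∧
      (∀ x, AbsCont (V x) (W x)) ∧ ∑ x, P x * klDiv (V x) (W x) ≤ B := by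
  have hpos : ∀ n : ℕ, (0 : ℝ) < 1 / ((n : ℝ) + 1) := fun n => Nat.one_div_pos_of_nat
  choose ρ hout hbound using fun n : ℕ => exists_regularized_dual_maximizer hW hB (hpos n)
  obtain ⟨V, hV, φ, hφ, hlim⟩ := isCompact_setOf_isChannel.tendsto_subseq
    fun n => isChannel_tilt hW (ρ n)
  have hlim' : ∀ x z, Tendsto (fun n => tilt W (ρ (φ n)) x z) atTop (nhds (V x z)) :=
    fun x z => tendsto_pi_nhds.1 (tendsto_pi_nhds.1 hlim x) z
  have habs : ∀ (σ : 𝒵 → ℝ) x, AbsCont (tilt W σ x) (W x) := fun σ x z hz =>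
    ((hW x).1 z).lt_of_ne fun h => by simp [tilt, ← h] at hz
  have habsV : ∀ x, AbsCont (V x) (W x) := fun x z hz =>
    ((hW x).1 z).lt_of_ne fun h => hz.ne' <| tendsto_nhds_unique (hlim' x z) <| by
      simp [tilt, ← h]
  refine ⟨V, hV, fun z => ?_, habsV, ?_⟩
  · have hsmall : Tendsto (fun n => outDist P (tilt W (ρ n)) z - Q z) atTop (nhds 0) := by
      have hsq : Tendsto (fun n : ℕ => Real.sqrt (4 * B * (1 / ((n : ℝ) + 1)))) atTop (nhds 0) := by
        simpa using (tendsto_one_div_add_atTop_nhds_zero_nat.const_mul (4 * B)).sqrt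
      refine squeeze_zero_norm (fun n => Real.abs_le_sqrt ?_) hsq
      have hz : ρ n z ^ 2 ≤ ∑ w, ρ n w ^ 2 :=
        Finset.single_le_sum (f := fun w => ρ n w ^ 2) (fun w _ => sq_nonneg _) (Finset.mem_univ z)
      have h1 := mul_le_mul_of_nonneg_left
        ((mul_le_mul_of_nonneg_left hz (hpos n).le).trans (hbound n)) (hpos n).le
      rw [hout n z]
      nlinarith
    have h1 : Tendsto (fun n => outDist P (tilt W (ρ (φ n))) z) atTop (nhds (outDist P V z)) :=
      tendsto_finsetSum _ fun x _ => (hlim' x z).const_mul (P x)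
    have h2 := (hsmall.comp hφ.tendsto_atTop).add_const (Q z)
    simp only [Function.comp_def, sub_add_cancel, zero_add] at h2
    exact tendsto_nhds_unique h1 h2
  · have hkl : Tendsto (fun n => ∑ x, P x * klDiv (tilt W (ρ (φ n)) x) (W x)) atTop
        (nhds (∑ x, P x * klDiv (V x) (W x))) := by
      refine tendsto_finsetSum _ fun x _ => Tendsto.const_mul (P x) ?_
      simp only [klDiv_eq_sum_log_sub_log (hV x).1 (habsV x),
        fun n => klDiv_eq_sum_log_sub_log (isChannel_tilt hW (ρ (φ n)) x).1 (habs _ x)]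
      exact tendsto_finsetSum _ fun z _ =>
        ((Real.continuous_mul_log.tendsto _).comp (hlim' x z)).sub ((hlim' x z).mul_const _)
    refine le_of_tendsto' hkl fun n => ?_
    rw [sum_klDiv_tilt P hW Q]
    have hneg : ∑ z, ρ (φ n) z * (outDist P (tilt W (ρ (φ n))) z - Q z) ≤ 0 :=
      Finset.sum_nonpos fun z _ => by
        rw [hout]
        nlinarith [mul_nonneg (hpos (φ n)).le (sq_nonneg (ρ (φ n) z))]
    linarith [hB (ρ (φ n))]

end Duality

theorem min_condKL_duality
    {𝒳 𝒵 : Type*} [Fintype 𝒳] [Fintype 𝒵] [Nonempty 𝒳] [Nonempty 𝒵]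
    (P : 𝒳 → ℝ) (W : 𝒳 → 𝒵 → ℝ) (QZ : 𝒵 → ℝ)
    (hP : IsPMF P) (hW : IsChannel W) (hQZ : IsPMF QZ)
    (hex : ∃ V₀ : 𝒳 → 𝒵 → ℝ, IsChannel V₀ ∧ (∀ z, outDist P V₀ z = QZ z) ∧
      ∀ x z, 0 < P x → 0 < V₀ x z → 0 < W x z) :
    sInf { d : EReal | ∃ V : 𝒳 → 𝒵 → ℝ, IsChannel V ∧ (∀ z, outDist P V z = QZ z) ∧
        d = condKL V W P }
      = sSup { e : EReal | ∃ ρ : 𝒵 → ℝ,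
          e = (((∑ z, ρ z * QZ z) -
            ∑ x, P x * Real.log (∑ z, W x z * Real.exp (ρ z)) : ℝ) : EReal) } := by
  change _ = sSup {e : EReal | ∃ ρ : 𝒵 → ℝ, e = (dualObj P W QZ ρ : EReal)}
  obtain ⟨V₀, hV₀, hout₀, habs₀⟩ := hex
  apply le_antisymm
  · set S := sSup {e : EReal | ∃ ρ : 𝒵 → ℝ, e = (dualObj P W QZ ρ : EReal)}
    have hle : ∀ ρ, (dualObj P W QZ ρ : EReal) ≤ S := fun ρ => le_sSup ⟨ρ, rfl⟩
    have htop : S ≠ ⊤ := by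
      refine ne_top_of_le_ne_top (EReal.coe_ne_top (∑ x, P x * klDiv (V₀ x) (W x))) (sSup_le ?_)
      rintro _ ⟨ρ, rfl⟩
      exact EReal.coe_le_coe_iff.2 (dualObj_le_sum_klDiv hP.1 hV₀ hW hout₀ habs₀ ρ)
    have hbot : S ≠ ⊥ := ne_bot_of_le_ne_bot (EReal.coe_ne_bot _) (hle 0)
    obtain ⟨V, hV, hout, habs, hVle⟩ := exists_channel_sum_klDiv_le hW (B := S.toReal) fun ρ => by
      rw [← EReal.coe_le_coe_iff, EReal.coe_toReal htop hbot]
      exact hle ρ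
    refine le_trans (b := condKL V W P) (sInf_le ⟨V, hV, hout, rfl⟩) ?_
    rw [condKL, if_pos fun x z _ => habs x z, ← EReal.coe_toReal htop hbot]
    exact EReal.coe_le_coe_iff.2 hVle
  · refine sSup_le ?_
    rintro _ ⟨ρ, rfl⟩
    refine le_sInf ?_
    rintro _ ⟨V, hV, hout, rfl⟩
    rw [condKL]
    split_ifs with h
    · exact EReal.coe_le_coe_iff.2 (dualObj_le_sum_klDiv hP.1 hV hW hout h ρ)
    · exact le_top

end
end

section
/- Fix finite nonempty sets 𝒳, 𝒵, a positive integer n, a channel W from 𝒳 to 𝒵 with n-fold product channel W^n from 𝒳^n to 𝒵^n, a pmf P_{X^n} on 𝒳^n, and positive integers M_s and M. Let the random codebook consist of M_s·M codewords X_{s,i} ∈ 𝒳^n (s ∈ {1,…,M_s}, i ∈ {1,…,M}) drawn i.i.d. from P_{X^n}. For each realization of the codebook define the pmfs on 𝒵^n: P_{C^s}(z^n) := (1/M) Σ_{i=1}^M W^n(z^n|X_{s,i}) and P_C(z^n) := (1/M_s) Σ_{s=1}^{M_s} P_{C^s}(z^n), and let P̄(z^n) := Σ_{x^n} P_{X^n}(x^n)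 W^n(z^n|x^n). Let S be uniform on {1,…,M_s} and, given the codebook and S=s, let Z^n have pmf P_{C^s}; let I(S;Z^n) denote the mutual information of the joint pmf of (S,Z^n) for the given codebook. Then E[ I(S;Z^n) ] = E[ D(P_{C^1} ‖ P̄) ] − E[ D(P_C ‖ P̄) ], where all expectations are over the random codebook, and all divergences are almost surely finite. -/
open Filter

noncomputable section

open scoped Classical in
/-- Extended-real KL divergence: `+∞` when `Q` is not absolutely continuous w.r.t. `Q'`. -/
def klDivE {α : Type*} [Fintype α] (Q Q' : α → ℝ) : EReal :=
  if AbsCont Q Q' then ((klDiv Q Q' : ℝ) : EReal) else ⊤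

/-- The `n`-fold memoryless extension `W^n(z^n|x^n) = Π_i W(z_i|x_i)`. -/
def prodW {𝒳 𝒵 : Type*} {n : ℕ} (W : 𝒳 → 𝒵 → ℝ) (x : Fin n → 𝒳) (z : Fin n → 𝒵) : ℝ :=
  ∏ i, W (x i) (z i)

/-- Output pmf on `𝒵^n` of the sub-code associated with message `s`:
`P_{C^s}(z^n) = (1/M) Σ_i W^n(z^n | X_{s,i})`. -/
def PCs {𝒳 𝒵 : Type*} {n Ms M : ℕ} (W : 𝒳 → 𝒵 → ℝ)
    (C : Fin Ms × Fin M → (Fin n → 𝒳)) (s : Fin Ms) (z : Fin n → 𝒵) : ℝ :=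
  (1 / (M : ℝ)) * ∑ i : Fin M, prodW W (C (s, i)) z

/-- Unconditional output pmf `P_C(z^n) = (1/M_s) Σ_s P_{C^s}(z^n)`. -/
def PCcode {𝒳 𝒵 : Type*} {n Ms M : ℕ} (W : 𝒳 → 𝒵 → ℝ)
    (C : Fin Ms × Fin M → (Fin n → 𝒳)) (z : Fin n → 𝒵) : ℝ :=
  (1 / (Ms : ℝ)) * ∑ s : Fin Ms, PCs W C s z

/-- Reference output pmf `P̄(z^n) = Σ_{x^n} P_{X^n}(x^n) W^n(z^n|x^n)`. -/
def Pbar {𝒳 𝒵 : Type*} [Fintype 𝒳] {n : ℕ} (W : 𝒳 → 𝒵 → ℝ)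
    (Pxn : (Fin n → 𝒳) → ℝ) (z : Fin n → 𝒵) : ℝ :=
  ∑ x : Fin n → 𝒳, Pxn x * prodW W x z

/-- Joint pmf of `(S, Z^n)` for a given codebook, `S` uniform on `{1,…,M_s}`. -/
def jointSZ {𝒳 𝒵 : Type*} {n Ms M : ℕ} (W : 𝒳 → 𝒵 → ℝ)
    (C : Fin Ms × Fin M → (Fin n → 𝒳)) : Fin Ms × (Fin n → 𝒵) → ℝ :=
  fun p => (1 / (Ms : ℝ)) * PCs W C p.1 p.2

/-- Mutual information `I(S;Z^n) = D(P_{S,Z^n} ‖ P_S × P_{Z^n})` for a given codebook. -/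
def MI {𝒳 𝒵 : Type*} [Fintype 𝒳] [Fintype 𝒵] {n Ms M : ℕ} (W : 𝒳 → 𝒵 → ℝ)
    (C : Fin Ms × Fin M → (Fin n → 𝒳)) : ℝ :=
  klDiv (jointSZ W C)
    (fun p => margX (jointSZ W C) p.1 * margZ (jointSZ W C) p.2)

/-- Probability of drawing the codebook `C` when the `M_s·M` codewords are i.i.d. `∼ P_{X^n}`. -/
def codeProb {𝒳 : Type*} {n Ms M : ℕ} (Pxn : (Fin n → 𝒳) → ℝ)
    (C : Fin Ms × Fin M → (Fin n → 𝒳)) : ℝ :=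
  ∏ si : Fin Ms × Fin M, Pxn (C si)

/-- Expectation over the random codebook. -/
def codeExp {𝒳 : Type*} [Fintype 𝒳] {n Ms M : ℕ} (Pxn : (Fin n → 𝒳) → ℝ)
    (f : (Fin Ms × Fin M → (Fin n → 𝒳)) → ℝ) : ℝ :=
  ∑ C : Fin Ms × Fin M → (Fin n → 𝒳), codeProb Pxn C * f C

theorem klDiv_eq_sum_mul_log {α : Type*} [Fintype α] {Q : α → ℝ} (hQ : ∀ a, 0 ≤ Q a)
    (Q' : α → ℝ) : klDiv Q Q' = ∑ a, Q a * Real.log (Q a / Q' a) := by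
  refine Finset.sum_congr rfl fun a _ => ?_
  split_ifs with h
  · rfl
  · simp [le_antisymm (not_lt.mp h) (hQ a)]

theorem klDivE_ne_top_of_absCont {α : Type*} [Fintype α] {Q Q' : α → ℝ}
    (h : AbsCont Q Q') : klDivE Q Q' ≠ ⊤ := by
  rw [klDivE, if_pos h]
  exact EReal.coe_ne_top _

theorem absCont_PCcode {𝒳 𝒵 : Type*} {n Ms M : ℕ} {W : 𝒳 → 𝒵 → ℝ}
    {R : (Fin n → 𝒵) → ℝ} {C : Fin Ms × Fin M → (Fin n → 𝒳)}
    (h : ∀ s, AbsCont (PCs W C s) R) : AbsCont (PCcode W C) R := by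
  intro z hz
  have hsum : 0 < ∑ s, PCs W C s z := pos_of_mul_pos_right hz (by positivity)
  obtain ⟨s, -, hs⟩ := Finset.exists_lt_of_sum_lt (f := fun _ => (0 : ℝ)) (by simpa using hsum)
  exact h s z hs

section Channel

variable {𝒳 𝒵 : Type*} [Fintype 𝒵] {n Ms M : ℕ} {W : 𝒳 → 𝒵 → ℝ}

theorem prodW_nonneg (hW : IsChannel W) (x : Fin n → 𝒳) (z : Fin n → 𝒵) : 0 ≤ prodW W x z :=
  Finset.prod_nonneg fun i _ => (hW (x i)).1 (z i)

theorem sum_prodW (hW : IsChannel W) (x : Fin n → 𝒳) : ∑ z, prodW W x z = 1 := by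
  classical
  simp only [prodW]
  rw [← Fintype.prod_sum]
  simp [(hW _).2]

theorem PCs_nonneg (hW : IsChannel W) (C : Fin Ms × Fin M → (Fin n → 𝒳)) (s : Fin Ms)
    (z : Fin n → 𝒵) : 0 ≤ PCs W C s z :=
  mul_nonneg (by positivity) (Finset.sum_nonneg fun _ _ => prodW_nonneg hW _ _)

theorem sum_PCs (hW : IsChannel W) (hM : 0 < M) (C : Fin Ms × Fin M → (Fin n → 𝒳))
    (s : Fin Ms) : ∑ z, PCs W C s z = 1 := by
  have hM' : (M : ℝ) ≠ 0 := by positivity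
  simp only [PCs]
  rw [← Finset.mul_sum, Finset.sum_comm]
  simp [sum_prodW hW, hM']

theorem PCcode_nonneg (hW : IsChannel W) (C : Fin Ms × Fin M → (Fin n → 𝒳))
    (z : Fin n → 𝒵) : 0 ≤ PCcode W C z :=
  mul_nonneg (by positivity) (Finset.sum_nonneg fun _ _ => PCs_nonneg hW _ _ _)

theorem PCcode_pos_of_PCs_pos (hW : IsChannel W) {C : Fin Ms × Fin M → (Fin n → 𝒳)}
    {s : Fin Ms} {z : Fin n → 𝒵} (h : 0 < PCs W C s z) : 0 < PCcode W C z := by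
  have hMs : 0 < Ms := s.pos
  exact mul_pos (by positivity)
    (Finset.sum_pos' (fun _ _ => PCs_nonneg hW _ _ _) ⟨s, Finset.mem_univ _, h⟩)

theorem absCont_PCs_Pbar [Fintype 𝒳] (hW : IsChannel W) {Pxn : (Fin n → 𝒳) → ℝ}
    (hPxn : ∀ x, 0 ≤ Pxn x) {C : Fin Ms × Fin M → (Fin n → 𝒳)} (hC : 0 < codeProb Pxn C)
    (s : Fin Ms) : AbsCont (PCs W C s) (Pbar W Pxn) := by
  intro z hz
  have hsum : 0 < ∑ i, prodW W (C (s, i)) z := pos_of_mul_pos_right hz (by positivity)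
  obtain ⟨i, -, hi⟩ := Finset.exists_lt_of_sum_lt (f := fun _ => (0 : ℝ)) (by simpa using hsum)
  have hP : 0 < Pxn (C (s, i)) :=
    (hPxn _).lt_of_ne' (Finset.prod_ne_zero_iff.mp hC.ne' (s, i) (Finset.mem_univ _))
  exact Finset.sum_pos' (fun x _ => mul_nonneg (hPxn x) (prodW_nonneg hW x z))
    ⟨C (s, i), Finset.mem_univ _, mul_pos hP hi⟩

/-- The mutual information of a codebook is the average divergence of its sub-codes from the
output pmf of the whole code. -/
theorem MI_eq_average_klDiv [Fintype 𝒳] (hW : IsChannel W) (hM : 0 < M)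
    (C : Fin Ms × Fin M → (Fin n → 𝒳)) :
    MI W C = (1 / (Ms : ℝ)) * ∑ s, klDiv (PCs W C s) (PCcode W C) := by
  have hX (s : Fin Ms) : margX (jointSZ W C) s = 1 / (Ms : ℝ) := by
    simp only [margX, jointSZ]
    rw [← Finset.mul_sum, sum_PCs hW hM, mul_one]
  have hZ (z : Fin n → 𝒵) : margZ (jointSZ W C) z = PCcode W C z :=
    (Finset.mul_sum _ _ _).symm
  have hnonneg (p : Fin Ms × (Fin n → 𝒵)) : 0 ≤ jointSZ W C p :=
    mul_nonneg (by positivity) (PCs_nonneg hW C p.1 p.2)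
  rw [MI, klDiv_eq_sum_mul_log hnonneg, Fintype.sum_prod_type, Finset.mul_sum]
  refine Finset.sum_congr rfl fun s _ => ?_
  have hMs : 0 < Ms := s.pos
  rw [klDiv_eq_sum_mul_log (PCs_nonneg hW C s), Finset.mul_sum]
  refine Finset.sum_congr rfl fun z _ => ?_
  rw [hX, hZ, jointSZ, mul_div_mul_left _ _ (by positivity), mul_assoc]

/-- The compensation identity for the sub-codes of a codebook. -/
theorem average_klDiv_PCcode_eq_sub (hW : IsChannel W) {R : (Fin n → 𝒵) → ℝ}
    {C : Fin Ms × Fin M → (Fin n → 𝒳)} (h : ∀ s, AbsCont (PCs W C s) R) :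
    (1 / (Ms : ℝ)) * ∑ s, klDiv (PCs W C s) (PCcode W C)
      = (1 / (Ms : ℝ)) * ∑ s, klDiv (PCs W C s) R - klDiv (PCcode W C) R := by
  have hcode : klDiv (PCcode W C) R
      = (1 / (Ms : ℝ)) * ∑ s, ∑ z, PCs W C s z * Real.log (PCcode W C z / R z) := by
    rw [klDiv_eq_sum_mul_log (PCcode_nonneg hW C), Finset.sum_comm, Finset.mul_sum]
    refine Finset.sum_congr rfl fun z _ => ?_
    rw [← Finset.sum_mul, ← mul_assoc]
    rfl
  rw [hcode, ← mul_sub, ← Finset.sum_sub_distrib]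
  congr 1
  refine Finset.sum_congr rfl fun s _ => ?_
  rw [klDiv_eq_sum_mul_log (PCs_nonneg hW C s), klDiv_eq_sum_mul_log (PCs_nonneg hW C s),
    ← Finset.sum_sub_distrib]
  refine Finset.sum_congr rfl fun z _ => ?_
  rcases (PCs_nonneg hW C s z).eq_or_lt with h0 | h0
  · simp [← h0]
  · have h1 := (PCcode_pos_of_PCs_pos hW h0).ne'
    have h2 := (h s z h0).ne'
    rw [Real.log_div h0.ne' h1, Real.log_div h0.ne' h2, Real.log_div h1 h2]
    ring

end Channel

/-- The law of the random codebook is invariant under permutations of the messages. -/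
theorem codeExp_comp_perm {𝒳 : Type*} [Fintype 𝒳] {n Ms M : ℕ} (Pxn : (Fin n → 𝒳) → ℝ)
    (f : (Fin Ms × Fin M → (Fin n → 𝒳)) → ℝ) (e : Equiv.Perm (Fin Ms)) :
    codeExp Pxn (fun C => f fun p => C (e p.1, p.2)) = codeExp Pxn f := by
  let σ : Equiv.Perm (Fin Ms × Fin M) := e.prodCongr (Equiv.refl _)
  refine Fintype.sum_equiv (σ.symm.arrowCongr (Equiv.refl (Fin n → 𝒳))) _ _ fun C => ?_
  congr 1
  exact (Equiv.prod_comp σ fun p => Pxn (C p)).symm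

theorem codeExp_klDiv_PCs_eq {𝒳 𝒵 : Type*} [Fintype 𝒳] [Fintype 𝒵] {n Ms M : ℕ}
    (W : 𝒳 → 𝒵 → ℝ) (Pxn : (Fin n → 𝒳) → ℝ) (R : (Fin n → 𝒵) → ℝ) (s t : Fin Ms) :
    codeExp Pxn (fun C : Fin Ms × Fin M → (Fin n → 𝒳) => klDiv (PCs W C s) R)
      = codeExp Pxn (fun C : Fin Ms × Fin M → (Fin n → 𝒳) => klDiv (PCs W C t) R) := by
  rw [← codeExp_comp_perm Pxn (fun C => klDiv (PCs W C t) R) (Equiv.swap s t)]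
  have hPCs (C : Fin Ms × Fin M → (Fin n → 𝒳)) :
      PCs W (fun p => C (Equiv.swap s t p.1, p.2)) t = PCs W C s := by
    funext z
    simp [PCs]
  simp only [hPCs]

theorem expected_leakage_eq_resolvability_difference
    {𝒳 𝒵 : Type*} [Fintype 𝒳] [Fintype 𝒵] [Nonempty 𝒳] [Nonempty 𝒵]
    (n Ms M : ℕ) (hn : 0 < n) (hMs : 0 < Ms) (hM : 0 < M)
    (W : 𝒳 → 𝒵 → ℝ) (hW : IsChannel W)
    (Pxn : (Fin n → 𝒳) → ℝ) (hPxn : IsPMF Pxn) :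
    (∀ C : Fin Ms × Fin M → (Fin n → 𝒳), 0 < codeProb Pxn C →
        (∀ s : Fin Ms, klDivE (PCs W C s) (Pbar W Pxn) ≠ ⊤) ∧
          klDivE (PCcode W C) (Pbar W Pxn) ≠ ⊤)
    ∧ codeExp Pxn (fun C : Fin Ms × Fin M → (Fin n → 𝒳) => MI W C)
        = codeExp Pxn (fun C : Fin Ms × Fin M → (Fin n → 𝒳) => klDiv (PCs W C ⟨0, hMs⟩) (Pbar W Pxn))
          - codeExp Pxn (fun C : Fin Ms × Fin M → (Fin n → 𝒳) => klDiv (PCcode W C) (Pbar W Pxn)) := by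
  have hac (C : Fin Ms × Fin M → (Fin n → 𝒳)) (hC : 0 < codeProb Pxn C) (s : Fin Ms) :
      AbsCont (PCs W C s) (Pbar W Pxn) := absCont_PCs_Pbar hW hPxn.1 hC s
  refine ⟨fun C hC => ⟨fun s => klDivE_ne_top_of_absCont (hac C hC s),
    klDivE_ne_top_of_absCont (absCont_PCcode (hac C hC))⟩, ?_⟩
  have hMs' : (Ms : ℝ) ≠ 0 := by positivity
  have havg : codeExp Pxn (fun C : Fin Ms × Fin M → (Fin n → 𝒳) =>
      klDiv (PCs W C ⟨0, hMs⟩) (Pbar W Pxn))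
      = codeExp Pxn (fun C : Fin Ms × Fin M → (Fin n → 𝒳) =>
        (1 / (Ms : ℝ)) * ∑ s, klDiv (PCs W C s) (Pbar W Pxn)) := by
    have hswap : codeExp Pxn (fun C : Fin Ms × Fin M → (Fin n → 𝒳) =>
        (1 / (Ms : ℝ)) * ∑ s, klDiv (PCs W C s) (Pbar W Pxn))
        = (1 / (Ms : ℝ)) * ∑ s, codeExp Pxn (fun C : Fin Ms × Fin M → (Fin n → 𝒳) =>
          klDiv (PCs W C s) (Pbar W Pxn)) := by
      simp only [codeExp]
      rw [Finset.sum_comm, Finset.mul_sum]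
      refine Finset.sum_congr rfl fun C _ => ?_
      rw [← Finset.mul_sum]
      ring
    rw [hswap, Finset.sum_congr rfl fun s _ =>
      codeExp_klDiv_PCs_eq W Pxn (Pbar W Pxn) s ⟨0, hMs⟩]
    simp [hMs']
  rw [havg]
  simp only [codeExp]
  rw [← Finset.sum_sub_distrib]
  refine Finset.sum_congr rfl fun C _ => ?_
  have hnonneg : 0 ≤ codeProb Pxn C := Finset.prod_nonneg fun _ _ => hPxn.1 _
  rcases hnonneg.eq_or_lt with h0 | h0
  · simp [← h0]
  · rw [← mul_sub, MI_eq_average_klDiv hW hM, average_klDiv_PCcode_eq_sub hW (hac C h0)]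

end
end
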